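/- Let δ ≥ 0 and let Q be a finite nonempty set of points in EuclideanSpace ℝ (Fin d) with centroid μ(Q) and radius ρ(Q). If q is a point with ‖q − μ(Q)‖ ≤ (1 + δ) · ρ(Q), then cost(Q, q) ≤ (1 + (1 + δ)²) · cost(Q, μ(Q)). -/

import Mathlib

/-- `cost Q c = ∑_{q ∈ Q} ‖q - c‖²` -/
noncomputable def cost {d : ℕ} (Q : Finset (EuclideanSpace ℝ (Fin d)))
    (c : EuclideanSpace ℝ (Fin d)) : ℝ := ∑ q ∈ Q, ‖q - c‖ ^ 2

/-- `mu Q` is the centroid (mean) of the finite set `Q`. -/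
noncomputable def mu {d : ℕ} (Q : Finset (EuclideanSpace ℝ (Fin d))) :
    EuclideanSpace ℝ (Fin d) := (Q.card : ℝ)⁻¹ • ∑ q ∈ Q, q

/-- The deviations of the points of `Q` from the centroid sum to zero. -/
theorem sum_sub_mu {d : ℕ} (Q : Finset (EuclideanSpace ℝ (Fin d))) :
    ∑ p ∈ Q, (p - mu Q) = 0 := by
  obtain rfl | hQ := Q.eq_empty_or_nonempty
  · simp
  · have hcard : (Q.card : ℝ) ≠ 0 := Nat.cast_ne_zero.mpr hQ.card_ne_zero
    rw [Finset.sum_sub_distrib, Finset.sum_const, ← Nat.cast_smul_eq_nsmul ℝ, mu,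
      smul_inv_smul₀ hcard, sub_self]

/-- The parallel axis identity: moving the center from the centroid to `c` increases the cost by
`|Q| ‖c - μ(Q)‖²`. -/
theorem cost_eq_cost_mu_add {d : ℕ} (Q : Finset (EuclideanSpace ℝ (Fin d)))
    (c : EuclideanSpace ℝ (Fin d)) :
    cost Q c = cost Q (mu Q) + Q.card * ‖c - mu Q‖ ^ 2 := by
  have hterm (p : EuclideanSpace ℝ (Fin d)) :
      ‖p - c‖ ^ 2 = ‖p - mu Q‖ ^ 2 - 2 * inner ℝ (p - mu Q) (c - mu Q) + ‖c - mu Q‖ ^ 2 := by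
    rw [← norm_sub_sq_real, sub_sub_sub_cancel_right]
  simp only [cost, hterm]
  rw [Finset.sum_add_distrib, Finset.sum_sub_distrib, ← Finset.mul_sum, ← sum_inner, sum_sub_mu,
    inner_zero_left, Finset.sum_const, nsmul_eq_mul, mul_zero, sub_zero]

/-- Any point of the δ-core is a `(1 + (1+δ)²)`-approximate 1-means center:
if `‖q − μ(Q)‖ ≤ (1 + δ)·ρ(Q)` then `cost(Q, q) ≤ (1 + (1+δ)²)·cost(Q, μ(Q))`. -/
theorem core_point_is_good_center {d : ℕ} (δ : ℝ) (hδ : 0 ≤ δ)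
    (Q : Finset (EuclideanSpace ℝ (Fin d))) (hQ : Q.Nonempty)
    (ρ : ℝ) (hρ0 : 0 ≤ ρ) (hρ : ρ ^ 2 * (Q.card : ℝ) = cost Q (mu Q))
    (q : EuclideanSpace ℝ (Fin d)) (hq : ‖q - mu Q‖ ≤ (1 + δ) * ρ) :
    cost Q q ≤ (1 + (1 + δ) ^ 2) * cost Q (mu Q) := by
  have hsq : ‖q - mu Q‖ ^ 2 ≤ ((1 + δ) * ρ) ^ 2 := by gcongr
  calc cost Q q = cost Q (mu Q) + Q.card * ‖q - mu Q‖ ^ 2 := cost_eq_cost_mu_add Q q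
    _ ≤ cost Q (mu Q) + Q.card * ((1 + δ) * ρ) ^ 2 := by gcongr
    _ = (1 + (1 + δ) ^ 2) * cost Q (mu Q) := by rw [← hρ]; ring
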